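/- Let X be an obstruction for local tournament orientation completions with opposing arcs (a,b),(c,d) such that the underlying graph U(X) has no cut-vertices. Then the complement of U(X) contains at most six vertices that are not cut-vertices of the complement. -/

import Mathlib

variable {V : Type*}

/-- The forcing relation Γ on ordered pairs of adjacent vertices. -/
def Gamma (G : SimpleGraph V) (p q : V × V) : Prop :=
  (p.1 = q.1 ∧ p.2 = q.2) ∨
  (p.1 = q.2 ∧ p.2 ≠ q.1 ∧ ¬ G.Adj p.2 q.1) ∨
  (p.2 = q.1 ∧ p.1 ≠ q.2 ∧ ¬ G.Adj p.1 q.2)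

/-- Γ*: there is a Γ-sequence from one pair to another. -/
def GammaStar (G : SimpleGraph V) : V × V → V × V → Prop :=
  Relation.ReflTransGen (Gamma G)

/-- `D` is an orientation of `G` that is a local tournament. -/
def IsLocalTournamentOrientation (G : SimpleGraph V) (D : V → V → Prop) : Prop :=
  (∀ u v, D u v → G.Adj u v) ∧
  (∀ u v, G.Adj u v → (D u v ∨ D v u)) ∧
  (∀ u v, D u v → ¬ D v u) ∧
  (∀ u v w, D u v → D u w → v ≠ w → G.Adj v w) ∧
  (∀ u v w, D v u → D w u → v ≠ w → G.Adj v w)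

/-- `A` is a set of arcs partially orienting `G`. -/
def IsPartialOrientation (G : SimpleGraph V) (A : V → V → Prop) : Prop :=
  (∀ u v, A u v → G.Adj u v) ∧ (∀ u v, A u v → ¬ A v u)

/-- The partially oriented graph `(G, A)` can be completed to a local tournament. -/
def CompletesToLocalTournament (G : SimpleGraph V) (A : V → V → Prop) : Prop :=
  ∃ D, IsLocalTournamentOrientation G D ∧ ∀ u v, A u v → D u v

/-- An obstruction for local tournament orientation completions. -/
def IsObstruction (G : SimpleGraph V) (A : V → V → Prop) : Prop :=
  IsPartialOrientation G A ∧
  ¬ CompletesToLocalTournament G A ∧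
  (∀ v : V, CompletesToLocalTournament (G.induce {u | u ≠ v})
      (fun a b => A a.1 b.1)) ∧
  (∀ a b, A a b →
    CompletesToLocalTournament G (fun u v => A u v ∧ ¬(u = a ∧ v = b)))

/-- A cut-vertex: deleting it increases the number of connected components. -/
def IsCutVertex (G : SimpleGraph V) (v : V) : Prop :=
  Nat.card G.ConnectedComponent <
    Nat.card ((G.induce {u | u ≠ v}).ConnectedComponent)

/-- `v` is the `(x,y)`-balancing vertex: the unique vertex (other than `x,y`)
adjacent to exactly one of `x, y`. -/
def IsArcBalancingFor (G : SimpleGraph V) (x y v : V) : Prop :=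
  v ≠ x ∧ v ≠ y ∧ Xor' (G.Adj v x) (G.Adj v y) ∧
  ∀ w, w ≠ x → w ≠ y → Xor' (G.Adj w x) (G.Adj w y) → w = v

/-- `u` and `v` are distinguished by some third vertex. -/
def Unb {W : Type*} (H : SimpleGraph W) (u v : W) : Prop :=
  ∃ z, (H.Adj z u ∧ z ≠ v ∧ ¬ H.Adj z v) ∨ (H.Adj z v ∧ z ≠ u ∧ ¬ H.Adj z u)

def ClawFree {W : Type*} (H : SimpleGraph W) : Prop :=
  ∀ x p q r, H.Adj x p → H.Adj x q → H.Adj x r → p ≠ q → p ≠ r → q ≠ r →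
    ¬ H.Adj p q → ¬ H.Adj p r → ¬ H.Adj q r → False

/-- a labelling of pairs constant on edges of induced paths -/
def Lab {W Q : Type*} (H : SimpleGraph W) (c : W → W → Q) : Prop :=
  (∀ u v, c u v = c v u) ∧
  (∀ u v w, H.Adj u v → H.Adj u w → v ≠ w → ¬ H.Adj v w → c u v = c u w)

/-- complement reachability inside the neighbourhood of `x` -/
def NR {W : Type*} (H : SimpleGraph W) (x : W) : W → W → Prop :=
  Relation.ReflTransGen (fun p q => H.Adj x p ∧ H.Adj x q ∧ p ≠ q ∧ ¬ H.Adj p q)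

theorem closed_of_reach {W : Type*} {H : SimpleGraph W} (S : W → Prop)
    (hS : ∀ u w, S u → H.Adj u w → S w) {u w : W} (h : H.Reachable u w) (hu : S u) : S w := by
  rw [SimpleGraph.reachable_iff_reflTransGen] at h
  induction h with
  | refl => exact hu
  | tail _ h2 ih => exact hS _ _ ih h2

section star
variable {W Q : Type*} {H : SimpleGraph W} {c : W → W → Q}

theorem NR.adj {x d y : W} (hd : H.Adj x d) (h : NR H x d y) : H.Adj x y := by
  induction h with
  | refl => exact hd
  | tail _ h2 _ => exact h2.2.1

theorem NR.lab (hc : Lab H c) {x d y : W} (h : NR H x d y) : c x d = c x y := by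
  induction h with
  | refl => rfl
  | tail _ h2 ih => exact ih.trans (hc.2 _ _ _ h2.1 h2.2.1 h2.2.2.1 h2.2.2.2)

theorem NR.step {x d y z : W} (h : NR H x d y) (h1 : H.Adj x y) (h2 : H.Adj x z)
    (h3 : y ≠ z) (h4 : ¬ H.Adj y z) : NR H x d z :=
  Relation.ReflTransGen.tail h ⟨h1, h2, h3, h4⟩

theorem NR.symm {x d y : W} (h : NR H x d y) : NR H x y d := by
  induction h with
  | refl => exact Relation.ReflTransGen.refl
  | tail _ h2 ih =>
    exact Relation.ReflTransGen.head
      ⟨h2.2.1, h2.1, h2.2.2.1.symm, fun h => h2.2.2.2 h.symm⟩ ih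

theorem NR.complete {x d y e : W} (hd : H.Adj x d) (h : NR H x d y) (he : H.Adj x e)
    (hn : ¬ NR H x d e) : H.Adj y e := by
  by_contra hcon
  by_cases hye : y = e
  · subst hye; exact hn h
  · exact hn (h.step (h.adj hd) he hye hcon)

theorem attach {x d' : W} (hd' : H.Adj x d') (hr : Hᶜ.Reachable d' x) :
    ∃ n p, n ≠ x ∧ ¬ H.Adj x n ∧ NR H x d' p ∧ ¬ H.Adj n p := by
  by_contra hcon
  push Not at hcon
  have := closed_of_reach (fun y => NR H x d' y) (fun u w hu huw => by
    rw [SimpleGraph.compl_adj] at huw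
    have hxu := hu.adj hd'
    by_cases hxw : H.Adj x w
    · exact hu.step hxu hxw huw.1 huw.2
    · by_cases hwx : w = x
      · subst hwx; exact absurd hxu.symm huw.2
      · exact absurd (hcon w u hwx hxw hu).symm huw.2) hr Relation.ReflTransGen.refl
  exact H.irrefl (this.adj hd')

theorem half_star (hconn : ∀ u w, H.Reachable u w) (hclaw : ClawFree H) (hc : Lab H c)
    {x d d' : W} (hd : H.Adj x d) (hd' : H.Adj x d') (hu : Unb H x d)
    (hr : Hᶜ.Reachable d' x) (hdis : ¬ NR H x d d')
    (hyp : ∀ n p, n ≠ x → ¬ H.Adj x n → NR H x d' p → ¬ H.Adj n p →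
      ∀ y, NR H x d y → ¬ H.Adj n y) : c x d = c x d' := by
  obtain ⟨n2, p2, hn2x, hxn2, hp2, hnp2⟩ := attach hd' hr
  have hdd : ∀ y, NR H x d y → ¬ NR H x d' y := fun y h1 h2 =>
    hdis (Relation.ReflTransGen.trans h1 h2.symm)
  have ha : ∃ n1 y1, n1 ≠ x ∧ ¬ H.Adj x n1 ∧ NR H x d y1 ∧ H.Adj n1 y1 := by
    by_contra hcon
    push Not at hcon
    obtain ⟨z, hz⟩ := hu
    rcases hz with ⟨h1, h2, h3⟩ | ⟨h1, h2, h3⟩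
    · have hz : NR H x d z :=
        NR.step Relation.ReflTransGen.refl hd h1.symm h2.symm (fun h => h3 h.symm)
      have := closed_of_reach (H := H) (fun y => y = x ∨ H.Adj x y) (fun u w hu huw => by
        rcases hu with rfl | hu
        · exact Or.inr huw
        · by_contra hw
          push Not at hw
          by_cases huD : NR H x d u
          · exact hcon w u hw.1 hw.2 huD huw.symm
          · have e1 := NR.complete hd Relation.ReflTransGen.refl hu huD
            have e2 := NR.complete hd hz hu huD
            refine hclaw u d z w e1.symm e2.symm huw h2.symm ?_ ?_ (fun h => h3 h.symm) ?_ ?_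
            · rintro rfl; exact hw.2 hd
            · rintro rfl; exact hw.2 h1.symm
            · exact fun h => hcon w d hw.1 hw.2 Relation.ReflTransGen.refl h.symm
            · exact fun h => hcon w z hw.1 hw.2 hz h.symm) (hconn x n2) (Or.inl rfl)
      rcases this with h | h
      · exact hn2x h
      · exact hxn2 h
    · exact hcon z d h2 (fun h => h3 h.symm) Relation.ReflTransGen.refl h1
  by_contra hne
  obtain ⟨n1, y1, hn1x, hxn1, hy1, hn1y1⟩ := ha
  have hxy1 := hy1.adj hd
  -- edges at vertices of N1
  have full : ∀ n y, n ≠ x → ¬ H.Adj x n → NR H x d y → H.Adj n y →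
      ∀ p, NR H x d' p → H.Adj n p := by
    intro n y h1 h2 h3 h4 p hp
    by_contra h5
    exact hyp n p h1 h2 hp h5 y h3 h4
  have lx : ∀ y n, H.Adj x y → n ≠ x → ¬ H.Adj x n → H.Adj n y → c x y = c n y := by
    intro y n h1 h2 h3 h4
    rw [hc.1 x y, hc.1 n y]
    exact hc.2 y x n h1.symm h4.symm h2.symm h3
  have b1 : ∀ n y m p, n ≠ x → ¬ H.Adj x n → NR H x d y → H.Adj n y → m ≠ x → ¬ H.Adj x m →
      NR H x d' p → ¬ H.Adj m p → ¬ H.Adj m n := by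
    intro n y m p h1 h2 h3 h4 h5 h6 h7 h8 h9
    have hnp := full n y h1 h2 h3 h4 p h7
    have hmy := hyp m p h5 h6 h7 h8 y h3
    apply hne
    have hxy := h3.adj hd
    have hxp := h7.adj hd'
    have e1 := h3.lab hc
    have e2 := h7.lab hc
    have e3 := lx y n hxy h1 h2 h4
    have e4 := lx p n hxp h1 h2 hnp
    have e5 := hc.2 n y m h4 h9.symm (by rintro rfl; exact h6 hxy) (fun h => hmy h.symm)
    have e6 := hc.2 n p m hnp h9.symm (by rintro rfl; exact h6 hxp) (fun h => h8 h.symm)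
    rw [e1, e2, e3, e4, e5, e6]
  have b2 : ∀ m p q, m ≠ x → ¬ H.Adj x m → NR H x d' p → ¬ H.Adj m p → NR H x d' q →
      ¬ H.Adj m q := by
    intro m p q h1 h2 h3 h4 h5 h6
    have hmn := b1 n1 y1 m p hn1x hxn1 hy1 hn1y1 h1 h2 h3 h4
    have hf := full n1 y1 hn1x hxn1 hy1 hn1y1
    refine hclaw q x m n1 (h5.adj hd').symm h6.symm (hf q h5).symm h1.symm hn1x.symm ?_ h2 hxn1 hmn
    rintro rfl
    exact h4 (hf p h3)
  have hfin := closed_of_reach (H := H)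
    (fun m => m ≠ x ∧ ¬ H.Adj x m ∧ ∃ p, NR H x d' p ∧ ¬ H.Adj m p) (fun m e hm hme => by
      obtain ⟨hm1, hm2, p, hp, hmp⟩ := hm
      have hmD := hyp m p hm1 hm2 hp hmp
      have hmD' := fun q hq => b2 m p q hm1 hm2 hp hmp hq
      have hmn := b1 n1 y1 m p hn1x hxn1 hy1 hn1y1 hm1 hm2 hp hmp
      have hf := full n1 y1 hn1x hxn1 hy1 hn1y1
      have hmn1 : m ≠ n1 := by rintro rfl; exact hmp (hf p hp)
      have hd'n := hf d' Relation.ReflTransGen.refl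
      have e1 := hy1.lab hc
      have e3 := lx y1 n1 hxy1 hn1x hxn1 hn1y1
      have e4 := lx d' n1 hd' hn1x hxn1 hd'n
      have hmd' := hmD' d' Relation.ReflTransGen.refl
      have hmy1 := hmD y1 hy1
      have hmy1' : m ≠ y1 := by rintro rfl; exact hm2 hxy1
      have hmd'' : m ≠ d' := by rintro rfl; exact hm2 hd'
      by_cases hex : e = x
      · subst hex; exact absurd hme.symm hm2
      by_cases hxe : H.Adj x e
      · exfalso
        by_cases heD : NR H x d e
        · exact hmD e heD hme
        by_cases heD' : NR H x d' e
        · exact hmD' e heD' hme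
        have hn : ¬ H.Adj e n1 := fun h =>
          hclaw e x m n1 hxe.symm hme.symm h hm1.symm hn1x.symm hmn1 hm2 hxn1 hmn
        have hen : e ≠ n1 := by rintro rfl; exact hxn1 hxe
        have a1 := NR.complete hd hy1 hxe heD
        have a2 := NR.complete hd' Relation.ReflTransGen.refl hxe heD'
        have f1 := hc.2 y1 n1 e hn1y1.symm a1 hen.symm (fun h => hn h.symm)
        have f2 := hc.2 d' n1 e hd'n.symm a2 hen.symm (fun h => hn h.symm)
        have f3 := hc.2 e m y1 hme.symm a1.symm hmy1' hmy1
        have f4 := hc.2 e m d' hme.symm a2.symm hmd'' hmd'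
        apply hne
        rw [e1, e3, e4, hc.1 n1 y1, hc.1 n1 d', f1, f2, hc.1 y1, hc.1 d', ← f3, ← f4]
      · refine ⟨hex, hxe, ?_⟩
        by_contra hcon
        push Not at hcon
        have heD : ∀ y, NR H x d y → ¬ H.Adj e y := fun y hy hey =>
          b1 e y m p hex hxe hy hey hm1 hm2 hp hmp hme
        have hen : e ≠ n1 := by rintro rfl; exact heD y1 hy1 hn1y1
        have hed' := hcon d' Relation.ReflTransGen.refl
        have hen1 : H.Adj e n1 := by
          by_contra h
          exact hclaw d' x e n1 hd'.symm hed'.symm hd'n.symm (Ne.symm hex) hn1x.symm hen hxe hxn1 h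
        have f1 := hc.2 n1 y1 e hn1y1 hen1.symm (by rintro rfl; exact hxe hxy1)
          (fun h => heD y1 hy1 h.symm)
        have f2 := hc.2 e m n1 hme.symm hen1 hmn1 hmn
        have f3 := hc.2 e m d' hme.symm hed' hmd'' hmd'
        have f4 := lx d' e hd' hex hxe hed'
        apply hne
        rw [e1, e3, f1, hc.1, ← f2, f3, f4]) (hconn n2 x) ⟨hn2x, hxn2, p2, hp2, hnp2⟩
  exact hfin.1 rfl

theorem star (hconn : ∀ u w, H.Reachable u w) (hclaw : ClawFree H) (hc : Lab H c)
    {x d d' : W} (hd : H.Adj x d) (hd' : H.Adj x d') (hu : Unb H x d) (hu' : Unb H x d')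
    (hr : Hᶜ.Reachable d x) (hr' : Hᶜ.Reachable d' x) : c x d = c x d' := by
  by_cases hdis : NR H x d d'
  · exact hdis.lab hc
  have hdis' : ¬ NR H x d' d := fun h => hdis h.symm
  by_contra hne
  -- the edges between the two parts
  have key : ∀ d d', H.Adj x d → H.Adj x d' → ¬ NR H x d d' → ∀ n p y, n ≠ x → ¬ H.Adj x n →
      NR H x d' p → ¬ H.Adj n p → NR H x d y → H.Adj n y → c x d = c d d' := by
    intro d d' hd hd' hdis n p y h1 h2 h3 h4 h5 h6
    have hxy := h5.adj hd
    have hxp := h3.adj hd'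
    have hcomp : ∀ u v, NR H x d u → NR H x d' v → H.Adj u v := fun u v hu hv =>
      NR.complete hd hu (hv.adj hd') (fun h => hdis (Relation.ReflTransGen.trans h hv.symm))
    have g1 : ∀ u, NR H x d u → c d d' = c u d' := by
      intro u hu
      induction hu with
      | refl => rfl
      | @tail v w hv h2 ih =>
        rw [ih, hc.1 v, hc.1 w]
        exact hc.2 _ _ _ (hcomp v d' hv Relation.ReflTransGen.refl).symm
          (hcomp w d' (hv.tail h2) Relation.ReflTransGen.refl).symm h2.2.2.1 h2.2.2.2
    have g2 : ∀ v, NR H x d' v → c y d' = c y v := by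
      intro u hu
      induction hu with
      | refl => rfl
      | @tail v w hv h2 ih =>
        rw [ih]
        exact hc.2 _ _ _ (hcomp y v h5 hv) (hcomp y w h5 (hv.tail h2)) h2.2.2.1 h2.2.2.2
    rw [h5.lab hc, g1 y h5, g2 p h3, hc.1 x y, hc.2 y x n hxy.symm h6.symm h1.symm h2]
    exact hc.2 y n p h6.symm (hcomp y p h5 h3) (by rintro rfl; exact h2 hxp) h4
  by_cases hA : ∀ n p, n ≠ x → ¬ H.Adj x n → NR H x d' p → ¬ H.Adj n p →
      ∀ y, NR H x d y → ¬ H.Adj n y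
  · exact hne (half_star hconn hclaw hc hd hd' hu hr' hdis hA)
  by_cases hB : ∀ n p, n ≠ x → ¬ H.Adj x n → NR H x d p → ¬ H.Adj n p →
      ∀ y, NR H x d' y → ¬ H.Adj n y
  · exact hne (half_star hconn hclaw hc hd' hd hu' hr hdis' hB).symm
  push Not at hA hB
  obtain ⟨n, p, h1, h2, h3, h4, y, h5, h6⟩ := hA
  obtain ⟨n', p', h1', h2', h3', h4', y', h5', h6'⟩ := hB
  apply hne
  rw [key d d' hd hd' hdis n p y h1 h2 h3 h4 h5 h6,
    key d' d hd' hd hdis' n' p' y' h1' h2' h3' h4' h5' h6', hc.1]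

theorem Unb.symm {u v : W} (h : Unb H u v) : Unb H v u := by
  obtain ⟨z, h⟩ := h
  exact ⟨z, h.symm⟩

theorem same_comp (hconn : ∀ u w, H.Reachable u w) (hclaw : ClawFree H) (hc : Lab H c)
    {a b e f : W} (hab : H.Adj a b) (hef : H.Adj e f) (hu : Unb H a b) (hu' : Unb H e f)
    (h1 : Hᶜ.Reachable a b) (h2 : Hᶜ.Reachable a e) (h3 : Hᶜ.Reachable a f) :
    c a b = c e f := by
  -- good vertices
  let good : W → Prop := fun u => ∀ w, Hᶜ.Reachable a u → Hᶜ.Reachable a w → H.Adj u w →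
    Unb H u w → c a b = c u w
  have ga : good a := fun w _ h5 h6 h7 =>
    star hconn hclaw hc hab h6 hu h7 h1.symm h5.symm
  have gb : good b := fun w h4 h5 h6 h7 => by
    rw [hc.1 a b]
    exact star hconn hclaw hc hab.symm h6 hu.symm h7 h1 (h5.symm.trans h4)
  have prop : ∀ u v, good u → Hᶜ.Reachable a u → Hᶜ.Reachable a v → H.Adj u v → good v := by
    intro u v hg hau hav huv w _ haw hvw hvwu
    by_cases hun : Unb H u v
    · rw [hg v hau hav huv hun, hc.1 u v]
      exact star hconn hclaw hc huv.symm hvw hun.symm hvwu (hau.symm.trans hav)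
        (haw.symm.trans hav)
    · by_cases hwu : w = u
      · subst hwu; exact absurd hvwu.symm hun
      have hwadj : H.Adj w u := by
        by_contra h
        exact hun ⟨w, Or.inr ⟨hvw.symm, hwu, h⟩⟩
      have huw : Unb H u w := by
        obtain ⟨z, hz⟩ := hvwu
        rcases hz with ⟨z1, z2, z3⟩ | ⟨z1, z2, z3⟩
        · by_cases hzu : z = u
          · subst hzu; exact absurd hwadj.symm z3
          · refine ⟨z, Or.inl ⟨?_, z2, z3⟩⟩
            by_contra h
            exact hun ⟨z, Or.inr ⟨z1, hzu, h⟩⟩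
        · by_cases hzu : z = u
          · subst hzu; exact absurd huv z3
          · refine ⟨z, Or.inr ⟨z1, hzu, ?_⟩⟩
            intro h
            exact hun ⟨z, Or.inl ⟨h, z2, z3⟩⟩
      rw [hg w hau haw hwadj.symm huw, hc.1 u w, hc.1 v w]
      exact star hconn hclaw hc hwadj hvw.symm huw.symm hvwu.symm (hau.symm.trans haw)
        (hav.symm.trans haw)
  have ge : good e := by
    by_cases hall : ∀ w, Hᶜ.Reachable a w
    · exact closed_of_reach good (fun u w hg h => prop u w hg (hall u) (hall w) h) (hconn a e) ga
    push Not at hall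
    obtain ⟨w, hw⟩ := hall
    have hwadj : ∀ u, Hᶜ.Reachable a u → H.Adj w u := by
      intro u hu
      by_contra h
      refine hw (hu.trans (SimpleGraph.Adj.reachable ?_))
      rw [SimpleGraph.compl_adj]
      refine ⟨?_, fun h' => h h'.symm⟩
      rintro rfl; exact hw hu
    have hK : ∀ b z, Hᶜ.Reachable a b → z ≠ b → ¬ H.Adj z b → Hᶜ.Reachable a z := by
      intro b z hb hzb hz
      refine hb.trans (SimpleGraph.Adj.reachable ?_)
      rw [SimpleGraph.compl_adj]
      exact ⟨hzb.symm, fun h' => hz h'.symm⟩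
    by_cases hae : H.Adj a e
    · exact prop a e ga (SimpleGraph.Reachable.refl _) h2 hae
    by_cases hbe : H.Adj b e
    · exact prop b e gb h1 h2 hbe
    by_cases hea : a = e
    · subst hea; exact ga
    by_cases heb : b = e
    · subst heb; exact gb
    obtain ⟨z, hz⟩ := hu
    rcases hz with ⟨z1, z2, z3⟩ | ⟨z1, z2, z3⟩
    · have hz := hK b z h1 z2 z3
      have gz := prop a z ga (SimpleGraph.Reachable.refl _) hz z1.symm
      by_cases hze : z = e
      · subst hze; exact gz
      refine prop z e gz hz h2 ?_
      by_contra h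
      exact hclaw w z b e (hwadj z hz) (hwadj b h1) (hwadj e h2) z2 hze heb z3 h hbe
    · have hz := hK a z (SimpleGraph.Reachable.refl _) z2 z3
      have gz := prop b z gb h1 hz z1.symm
      by_cases hze : z = e
      · subst hze; exact gz
      refine prop z e gz hz h2 ?_
      by_contra h
      exact hclaw w z a e (hwadj z hz) (hwadj a (SimpleGraph.Reachable.refl _)) (hwadj e h2)
        z2 hze hea z3 h hae
  exact ge f h2 h3 hef hu'

theorem diff_comp (hc : Lab H c)
    {a b e f : W} (h1 : ¬ Hᶜ.Reachable a b) (h2 : Hᶜ.Reachable a e) (h3 : Hᶜ.Reachable b f) :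
    c a b = c e f := by
  have hadj : ∀ u v, Hᶜ.Reachable a u → Hᶜ.Reachable b v → H.Adj u v := by
    intro u v hu hv
    by_contra h
    by_cases huv : u = v
    · subst huv; exact h1 (hu.trans hv.symm)
    · exact h1 ((hu.trans (SimpleGraph.Adj.reachable
        (by rw [SimpleGraph.compl_adj]; exact ⟨huv, h⟩))).trans hv.symm)
  have s1 := closed_of_reach (H := Hᶜ) (fun u => Hᶜ.Reachable a u ∧ c a b = c u b)
    (fun u w hu huw => by
      have hw := hu.1.trans huw.reachable
      refine ⟨hw, ?_⟩
      rw [SimpleGraph.compl_adj] at huw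
      rw [hu.2, hc.1 u, hc.1 w]
      exact hc.2 _ _ _ (hadj u b hu.1 (SimpleGraph.Reachable.refl _)).symm
        (hadj w b hw (SimpleGraph.Reachable.refl _)).symm huw.1 huw.2) h2
    ⟨SimpleGraph.Reachable.refl _, rfl⟩
  have s2 := closed_of_reach (H := Hᶜ) (fun u => Hᶜ.Reachable b u ∧ c e b = c e u)
    (fun u w hu huw => by
      have hw := hu.1.trans huw.reachable
      refine ⟨hw, ?_⟩
      rw [SimpleGraph.compl_adj] at huw
      rw [hu.2]
      exact hc.2 _ _ _ (hadj e u h2 hu.1) (hadj e w h2 hw) huw.1 huw.2) h3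
    ⟨SimpleGraph.Reachable.refl _, rfl⟩
  exact s1.2.trans s2.2

theorem main_lab (hconn : ∀ u w, H.Reachable u w) (hclaw : ClawFree H) (hc : Lab H c)
    {a b e f : W} (hab : H.Adj a b) (hef : H.Adj e f) (hu : Unb H a b) (hu' : Unb H e f)
    (h : (Hᶜ.Reachable a e ∧ Hᶜ.Reachable b f) ∨ (Hᶜ.Reachable a f ∧ Hᶜ.Reachable b e)) :
    c a b = c e f := by
  by_cases h1 : Hᶜ.Reachable a b
  · rcases h with ⟨h2, h3⟩ | ⟨h2, h3⟩
    · exact same_comp hconn hclaw hc hab hef hu hu' h1 h2 (h1.trans h3)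
    · exact same_comp hconn hclaw hc hab hef hu hu' h1 (h1.trans h3) h2
  · rcases h with ⟨h2, h3⟩ | ⟨h2, h3⟩
    · exact diff_comp hc h1 h2 h3
    · rw [hc.1 e f]; exact diff_comp hc h1 h2 h3

end star

theorem clawFree_of_orient {W : Type*} {H : SimpleGraph W} {D : W → W → Prop}
    (hD : IsLocalTournamentOrientation H D) : ClawFree H := by
  obtain ⟨_, h2, _, h4, h5⟩ := hD
  intro x p q r hp hq hr hpq hpr hqr n1 n2 n3
  rcases h2 _ _ hp with a | a <;> rcases h2 _ _ hq with b | b <;> rcases h2 _ _ hr with e | e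
  · exact n1 (h4 _ _ _ a b hpq)
  · exact n1 (h4 _ _ _ a b hpq)
  · exact n2 (h4 _ _ _ a e hpr)
  · exact n3 (h5 _ _ _ b e hqr)
  · exact n3 (h4 _ _ _ b e hqr)
  · exact n2 (h5 _ _ _ a e hpr)
  · exact n1 (h5 _ _ _ a b hpq)
  · exact n1 (h5 _ _ _ a b hpq)

theorem lab_of_orient {W : Type*} {H : SimpleGraph W} {D E : W → W → Prop}
    (hD : IsLocalTournamentOrientation H D) (hE : IsLocalTournamentOrientation H E) :
    Lab H (fun u v => (D u v ↔ E u v)) := by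
  obtain ⟨d1, d2, d3, d4, d5⟩ := hD
  obtain ⟨e1, e2, e3, e4, e5⟩ := hE
  constructor
  · intro u v
    have a1 := d1 u v
    have a2 := d1 v u
    have a3 := d2 u v
    have a4 := d3 u v
    have b1 := e1 u v
    have b2 := e1 v u
    have b3 := e2 u v
    have b4 := e3 u v
    apply propext
    tauto
  · intro u v w huv huw hne hn
    have a1 := d2 u v huv
    have a2 := d2 u w huw
    have a3 := d3 u v
    have a4 := d3 u w
    have a5 : ¬ (D u v ∧ D u w) := fun h => hn (d4 u v w h.1 h.2 hne)
    have a6 : ¬ (D v u ∧ D w u) := fun h => hn (d5 u v w h.1 h.2 hne)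
    have b1 := e2 u v huv
    have b2 := e2 u w huw
    have b3 := e3 u v
    have b4 := e3 u w
    have b5 : ¬ (E u v ∧ E u w) := fun h => hn (e4 u v w h.1 h.2 hne)
    have b6 : ¬ (E v u ∧ E w u) := fun h => hn (e5 u v w h.1 h.2 hne)
    have x : D u v ↔ ¬ D u w := by clear b1 b2 b3 b4 b5 b6; tauto
    have y : E u v ↔ ¬ E u w := by clear x a1 a2 a3 a4 a5 a6; tauto
    apply propext
    change (D u v ↔ E u v) ↔ (D u w ↔ E u w)
    rw [x, y]
    exact not_iff_not

/-- the undirected forcing step -/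
def LStep {W : Type*} (H : SimpleGraph W) (p q : W × W) : Prop :=
  H.Adj p.1 p.2 ∧ H.Adj q.1 q.2 ∧
    ((p.1 = q.2 ∧ p.2 = q.1) ∨ (p.1 = q.1 ∧ p.2 ≠ q.2 ∧ ¬ H.Adj p.2 q.2))

def Lk {W : Type*} (H : SimpleGraph W) (a b u v : W) : Prop :=
  Relation.ReflTransGen (LStep H) (a, b) (u, v)

section link
variable {W : Type*} {H : SimpleGraph W}

theorem Lk.swap {a b u v : W} (h : Lk H a b u v) (huv : H.Adj u v) : Lk H a b v u :=
  Relation.ReflTransGen.tail h ⟨huv, huv.symm, Or.inl ⟨rfl, rfl⟩⟩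

theorem Lk.p3 {a b u v w : W} (h : Lk H a b u v) (huv : H.Adj u v) (huw : H.Adj u w)
    (hne : v ≠ w) (hn : ¬ H.Adj v w) : Lk H a b u w :=
  Relation.ReflTransGen.tail h ⟨huv, huw, Or.inr ⟨rfl, hne, hn⟩⟩

theorem Lk.induct {a b : W} (P : W → W → Prop) (h0 : P a b)
    (hs : ∀ u v, H.Adj u v → P u v → P v u)
    (hp : ∀ u v w, H.Adj u v → H.Adj u w → v ≠ w → ¬ H.Adj v w → P u v → P u w)
    {u v : W} (h : Lk H a b u v) : P u v := by
  have : ∀ q : W × W, Relation.ReflTransGen (LStep H) (a, b) q → P q.1 q.2 := by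
    intro q hq
    induction hq with
    | refl => exact h0
    | @tail p q _ h2 ih =>
      obtain ⟨p1, p2⟩ := p
      obtain ⟨q1, q2⟩ := q
      obtain ⟨g1, g2, g3⟩ := h2
      simp only at g1 g2 g3 ih ⊢
      rcases g3 with ⟨rfl, rfl⟩ | ⟨rfl, k1, k2⟩
      · exact hs _ _ g1 ih
      · exact hp _ _ _ g1 g2 k1 k2 ih
  exact this (u, v) h

/-- reversing an orientation on a forcing class -/
theorem reverse_orient {D : W → W → Prop} (hD : IsLocalTournamentOrientation H D) (a b : W) :
    IsLocalTournamentOrientation H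
      (fun u v => (Lk H a b u v ∧ D v u) ∨ (¬ Lk H a b u v ∧ D u v)) := by
  obtain ⟨d1, d2, d3, d4, d5⟩ := hD
  have hsw : ∀ u v, H.Adj u v → (Lk H a b u v ↔ Lk H a b v u) := fun u v h =>
    ⟨fun k => k.swap h, fun k => k.swap h.symm⟩
  have hp : ∀ u v w, H.Adj u v → H.Adj u w → v ≠ w → ¬ H.Adj v w →
      (Lk H a b u v ↔ Lk H a b u w) := fun u v w h1 h2 h3 h4 =>
    ⟨fun k => k.p3 h1 h2 h3 h4, fun k => k.p3 h2 h1 h3.symm (fun h => h4 h.symm)⟩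
  have hadj : ∀ u v, ((Lk H a b u v ∧ D v u) ∨ (¬ Lk H a b u v ∧ D u v)) → H.Adj u v := by
    rintro u v (h | h)
    · exact (d1 _ _ h.2).symm
    · exact d1 _ _ h.2
  refine ⟨hadj, ?_, ?_, ?_, ?_⟩
  · intro u v h
    have := d2 u v h
    have := hsw u v h
    tauto
  · intro u v h
    have := hsw u v (hadj u v h)
    have := d3 u v
    tauto
  · intro u v w h1 h2 hne
    by_contra hn
    have := hp u v w (hadj _ _ h1) (hadj _ _ h2) hne hn
    have k1 : ¬ (D u v ∧ D u w) := fun h => hn (d4 u v w h.1 h.2 hne)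
    have k2 : ¬ (D v u ∧ D w u) := fun h => hn (d5 u v w h.1 h.2 hne)
    tauto
  · intro u v w h1 h2 hne
    by_contra hn
    have := hp u v w (hadj _ _ h1).symm (hadj _ _ h2).symm hne hn
    have := hsw _ _ (hadj _ _ h1)
    have := hsw _ _ (hadj _ _ h2)
    have k1 : ¬ (D u v ∧ D u w) := fun h => hn (d4 u v w h.1 h.2 hne)
    have k2 : ¬ (D v u ∧ D w u) := fun h => hn (d5 u v w h.1 h.2 hne)
    tauto

theorem Lk.unb_left {a b u v : W} (h : Lk H a b u v) (h1 : ¬ (u = a ∧ v = b))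
    (h2 : ¬ (u = b ∧ v = a)) : Unb H a b := by
  by_contra hun
  have := Lk.induct (H := H) (fun u v => (u = a ∧ v = b) ∨ (u = b ∧ v = a)) (Or.inl ⟨rfl, rfl⟩)
    (fun u v _ h => by tauto)
    (fun u v w k1 k2 k3 k4 h5 => by
      exfalso
      rcases h5 with ⟨rfl, rfl⟩ | ⟨rfl, rfl⟩
      · exact hun ⟨w, Or.inl ⟨k2.symm, k3.symm, fun h => k4 h.symm⟩⟩
      · exact hun ⟨w, Or.inr ⟨k2.symm, k3.symm, fun h => k4 h.symm⟩⟩) h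
  tauto

theorem Lk.symm {a b u v : W} (h : Lk H a b u v) : Lk H u v a b := by
  unfold Lk at *
  have hs : Std.Symm (LStep H) := ⟨?_⟩
  · exact (Relation.ReflTransGen.stdSymm (r := LStep H)).symm _ _ h
  rintro ⟨p1, p2⟩ ⟨q1, q2⟩ ⟨g1, g2, g3⟩
  refine ⟨g2, g1, ?_⟩
  rcases g3 with ⟨k1, k2⟩ | ⟨k1, k2, k3⟩
  · exact Or.inl ⟨k2.symm, k1.symm⟩
  · exact Or.inr ⟨k1.symm, k2.symm, fun h => k3 h.symm⟩

end link

theorem noncut_reach {W : Type*} [Fintype W] {M : SimpleGraph W} {v : W}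
    (hv : ¬ IsCutVertex M v) (u w : W) (hu : u ≠ v) (hw : w ≠ v) (h : M.Reachable u w) :
    (M.induce {u | u ≠ v}).Reachable ⟨u, hu⟩ ⟨w, hw⟩ := by
  classical
  by_cases hiso : ∃ z, M.Adj v z
  · obtain ⟨z, hz⟩ := hiso
    unfold IsCutVertex at hv
    push Not at hv
    let φ : (M.induce {u | u ≠ v}).ConnectedComponent → M.ConnectedComponent :=
      fun C => C.map (SimpleGraph.Embedding.induce {u | u ≠ v}).toHom
    have hφ : ∀ (y : W) (hy : y ≠ v),
        φ ((M.induce {u | u ≠ v}).connectedComponentMk ⟨y, hy⟩) = M.connectedComponentMk y :=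
      fun y hy => rfl
    have hsurj : Function.Surjective φ := by
      intro C
      induction C using SimpleGraph.ConnectedComponent.ind with
      | _ y =>
        by_cases hy : y = v
        · subst hy
          refine ⟨(M.induce {u | u ≠ y}).connectedComponentMk ⟨z, hz.ne'⟩, ?_⟩
          rw [hφ]
          exact SimpleGraph.ConnectedComponent.eq.2 hz.reachable.symm
        · exact ⟨_, hφ y hy⟩
    have hinj : Function.Injective φ :=
      (Function.Surjective.bijective_of_nat_card_le hsurj hv).1
    apply SimpleGraph.ConnectedComponent.eq.1
    apply hinj
    rw [hφ, hφ]
    exact SimpleGraph.ConnectedComponent.eq.2 h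
  · push Not at hiso
    obtain ⟨_, h⟩ := closed_of_reach (H := M)
      (fun y => ∃ hy : y ≠ v, (M.induce {u | u ≠ v}).Reachable ⟨u, hu⟩ ⟨y, hy⟩)
      (fun p q ⟨hp, hr⟩ hpq => by
        have hq : q ≠ v := by rintro rfl; exact hiso p hpq.symm
        refine ⟨hq, hr.trans (SimpleGraph.Adj.reachable ?_)⟩
        exact hpq) h ⟨hu, SimpleGraph.Reachable.refl _⟩
    exact h

theorem restrict_orient {W : Type*} {H : SimpleGraph W} {D : W → W → Prop}
    (hD : IsLocalTournamentOrientation H D) (s : Set W) :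
    IsLocalTournamentOrientation (H.induce s) (fun u v => D u.1 v.1) := by
  obtain ⟨d1, d2, d3, d4, d5⟩ := hD
  refine ⟨fun u v h => d1 _ _ h, fun u v h => d2 _ _ h, fun u v h => d3 _ _ h, ?_, ?_⟩
  · intro u v w h1 h2 h3
    exact d4 _ _ _ h1 h2 (fun h => h3 (Subtype.ext h))
  · intro u v w h1 h2 h3
    exact d5 _ _ _ h1 h2 (fun h => h3 (Subtype.ext h))

theorem compl_induce_reach {W : Type*} {H : SimpleGraph W} {s : Set W} {x y : s}
    (h : (Hᶜ.induce s).Reachable x y) : ((H.induce s)ᶜ).Reachable x y := by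
  refine h.mono ?_
  intro p q hpq
  have h' : Hᶜ.Adj p.1 q.1 := hpq
  rw [SimpleGraph.compl_adj] at h' ⊢
  exact ⟨fun h => h'.1 (congrArg _ h), h'.2⟩

/-- If X is an obstruction with opposing arcs whose underlying graph has no
cut-vertices, then the complement of the underlying graph has at most six
non-cut-vertices. -/
theorem at_most_six_non_cut_vertices [Fintype V] (G : SimpleGraph V)
    (A : V → V → Prop) (a b c d : V)
    (hobs : IsObstruction G A) (hab : A a b) (hcd : A c d)
    (hopp : GammaStar G (a, b) (d, c))
    (hnocut : ∀ v : V, ¬ IsCutVertex G v) :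
    Set.ncard {v : V | ¬ IsCutVertex Gᶜ v} ≤ 6 := by
  classical
  obtain ⟨⟨hA1, hA2⟩, hnc, hdel, harc⟩ := hobs
  clear hopp hcd c d
  obtain ⟨D, hD, hDA⟩ := harc a b hab
  have hDba : D b a := by
    rcases hD.2.1 a b (hA1 a b hab) with h | h
    · exfalso
      refine hnc ⟨D, hD, fun u v huv => ?_⟩
      by_cases he : u = a ∧ v = b
      · rw [he.1, he.2]; exact h
      · exact hDA u v ⟨huv, he⟩
    · exact h
  have hDab : ¬ D a b := hD.2.2.1 b a hDba
  have hex : ∃ e f, A e f ∧ ¬ (e = a ∧ f = b) ∧ Lk G a b e f := by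
    by_contra hcon
    push Not at hcon
    refine hnc ⟨_, reverse_orient hD a b, fun u v huv => ?_⟩
    by_cases he : u = a ∧ v = b
    · left
      rw [he.1, he.2]
      exact ⟨Relation.ReflTransGen.refl, hDba⟩
    · right
      exact ⟨hcon u v huv (by tauto), hDA u v ⟨huv, he⟩⟩
  obtain ⟨e, f, hef, hne, hlk⟩ := hex
  have hDef : D e f := hDA e f ⟨hef, hne⟩
  have hne' : ¬ (e = b ∧ f = a) := by
    rintro ⟨rfl, rfl⟩
    exact hA2 _ _ hab hef
  have hGab := hA1 a b hab
  have hGef := hA1 e f hef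
  have hu1 : Unb G a b := hlk.unb_left hne hne'
  have hu2 : Unb G e f := hlk.symm.unb_left (by tauto) (by tauto)
  obtain ⟨z1, hz1⟩ := hu1
  obtain ⟨z2, hz2⟩ := hu2
  -- deleted subgraphs
  have hdis : ∀ v (ha : a ≠ v) (hb : b ≠ v) (he : e ≠ v) (hf : f ≠ v)
      (E : {u | u ≠ v} → {u | u ≠ v} → Prop),
      (∀ u w : {u | u ≠ v}, A u.1 w.1 → E u w) →
      ((D a b ↔ E ⟨a, ha⟩ ⟨b, hb⟩) = (D e f ↔ E ⟨e, he⟩ ⟨f, hf⟩)) → False := by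
    intro v ha hb he hf E hE h
    have h1 := hE ⟨a, ha⟩ ⟨b, hb⟩ hab
    have h2 := hE ⟨e, he⟩ ⟨f, hf⟩ hef
    simp [hDab, hDef, h1, h2] at h
  -- connectedness
  have hGa : ∀ v, G.Reachable a v := by
    intro v
    by_contra hv
    have hr : ∀ y, G.Reachable a y → y ≠ v := by rintro y hy rfl; exact hv hy
    obtain ⟨E, hE, hEA⟩ := hdel v
    have hl := lab_of_orient (restrict_orient hD {u | u ≠ v}) hE
    have ha := hr a (SimpleGraph.Reachable.refl _)
    have hb := hr b hGab.reachable
    obtain ⟨r1, r2, k1, k2⟩ := Lk.induct (H := G) (fun p q => ∃ (_ : G.Reachable a p)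
      (_ : G.Reachable a q) (hp : p ≠ v) (hq : q ≠ v),
        (D a b ↔ E ⟨a, ha⟩ ⟨b, hb⟩) = (D p q ↔ E ⟨p, hp⟩ ⟨q, hq⟩))
      ⟨SimpleGraph.Reachable.refl _, hGab.reachable, ha, hb, rfl⟩
      (fun p q _ ⟨r1, r2, hp, hq, h⟩ =>
        ⟨r2, r1, hq, hp, h.trans (hl.1 ⟨p, hp⟩ ⟨q, hq⟩)⟩)
      (fun p q w h1 h2 h3 h4 ⟨r1, r2, hp, hq, h⟩ =>
        ⟨r1, r1.trans h2.reachable, hp, hr w (r1.trans h2.reachable),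
          h.trans (hl.2 ⟨p, hp⟩ ⟨q, hq⟩ ⟨w, hr w (r1.trans h2.reachable)⟩ h1 h2
            (fun h => h3 (congrArg Subtype.val h)) h4)⟩) hlk
    obtain ⟨k2, k3⟩ := k2
    exact hdis v ha hb k1 k2 E hEA k3
  -- position relative to the components of the complement
  have hpos : (Gᶜ.Reachable a e ∧ Gᶜ.Reachable b f) ∨ (Gᶜ.Reachable a f ∧ Gᶜ.Reachable b e) := by
    refine Lk.induct (H := G) (fun e f => (Gᶜ.Reachable a e ∧ Gᶜ.Reachable b f) ∨
      (Gᶜ.Reachable a f ∧ Gᶜ.Reachable b e))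
      (Or.inl ⟨SimpleGraph.Reachable.refl _, SimpleGraph.Reachable.refl _⟩)
      (fun u v _ h => by tauto) (fun u v w _ _ h3 h4 h => ?_) hlk
    have hr : Gᶜ.Reachable v w := SimpleGraph.Adj.reachable
      (by rw [SimpleGraph.compl_adj]; exact ⟨h3, h4⟩)
    rcases h with h | h
    · exact Or.inl ⟨h.1, h.2.trans hr⟩
    · exact Or.inr ⟨h.1.trans hr, h.2⟩
  have hsub : {v : V | ¬ IsCutVertex Gᶜ v} ⊆ (({a, b, e, f, z1, z2} : Finset V) : Set V) := by
    intro v hv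
    by_contra hmem
    simp only [Finset.coe_insert, Finset.coe_singleton, Set.mem_insert_iff,
      Set.mem_singleton_iff, not_or] at hmem
    obtain ⟨ha, hb, he, hf, h1, h2⟩ := hmem
    have ha := Ne.symm ha
    have hb := Ne.symm hb
    have he := Ne.symm he
    have hf := Ne.symm hf
    have h1 := Ne.symm h1
    have h2 := Ne.symm h2
    obtain ⟨E, hE, hEA⟩ := hdel v
    have hl := lab_of_orient (restrict_orient hD {u | u ≠ v}) hE
    have hunb : ∀ p q z (hp : p ≠ v) (hq : q ≠ v), z ≠ v →
        ((G.Adj z p ∧ z ≠ q ∧ ¬ G.Adj z q) ∨ (G.Adj z q ∧ z ≠ p ∧ ¬ G.Adj z p)) →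
        Unb (G.induce {u | u ≠ v}) ⟨p, hp⟩ ⟨q, hq⟩ := by
      intro p q z hp hq hz h
      refine ⟨⟨z, hz⟩, ?_⟩
      rcases h with ⟨k1, k2, k3⟩ | ⟨k1, k2, k3⟩
      · exact Or.inl ⟨k1, fun h => k2 (congrArg Subtype.val h), k3⟩
      · exact Or.inr ⟨k1, fun h => k2 (congrArg Subtype.val h), k3⟩
    have hcomp : ∀ p q (hp : p ≠ v) (hq : q ≠ v), Gᶜ.Reachable p q →
        ((G.induce {u | u ≠ v})ᶜ).Reachable ⟨p, hp⟩ ⟨q, hq⟩ := fun p q hp hq h =>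
      compl_induce_reach (noncut_reach hv p q hp hq h)
    refine hdis v ha hb he hf E hEA (main_lab (H := G.induce {u | u ≠ v}) ?_
      (clawFree_of_orient hE) hl (a := ⟨a, ha⟩) (b := ⟨b, hb⟩) (e := ⟨e, he⟩) (f := ⟨f, hf⟩)
      hGab hGef (hunb a b z1 ha hb h1 hz1) (hunb e f z2 he hf h2 hz2) ?_)
    · rintro ⟨p, hp⟩ ⟨q, hq⟩
      exact noncut_reach (hnocut v) p q hp hq ((hGa p).symm.trans (hGa q))
    · rcases hpos with ⟨k1, k2⟩ | ⟨k1, k2⟩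
      · exact Or.inl ⟨hcomp _ _ _ _ k1, hcomp _ _ _ _ k2⟩
      · exact Or.inr ⟨hcomp _ _ _ _ k1, hcomp _ _ _ _ k2⟩
  calc Set.ncard {v : V | ¬ IsCutVertex Gᶜ v}
      ≤ Set.ncard (({a, b, e, f, z1, z2} : Finset V) : Set V) :=
        Set.ncard_le_ncard hsub (Finset.finite_toSet _)
    _ = ({a, b, e, f, z1, z2} : Finset V).card := Set.ncard_coe_finset _
    _ ≤ 6 := Finset.card_le_six
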